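/- Moment convergence at the critical point: fix K ∈ ℕ. For each N let X_1,…,X_N be CW(1,N)-distributed and S_N = ∑_{i=1}^N X_i. Then, as N → ∞, E_{1,N}((S_N/N^{3/4})^K) converges to (∫_{−∞}^{∞} t^K e^{−t⁴/12} dt)/(∫_{−∞}^{∞} e^{−t⁴/12} dt), the K-th moment of the probability measure with Lebesgue density proportional to e^{−t⁴/12}. -/

import Mathlib

open MeasureTheory Filter Real Topology ENNReal

/-- The spin value associated to a Boolean: `true ↦ +1`, `false ↦ -1`. -/
noncomputable def spin (b : Bool) : ℝ := if b then 1 else -1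

/-- The (unnormalized) Curie–Weiss Boltzmann weight of a configuration. -/
noncomputable def cwWeight (β : ℝ) (N : ℕ) (σ : Fin N → Bool) : ℝ :=
  Real.exp (β / (2 * N) * (∑ i, spin (σ i)) ^ 2)

/-- The Curie–Weiss partition function. -/
noncomputable def cwZ (β : ℝ) (N : ℕ) : ℝ :=
  ∑ σ : Fin N → Bool, cwWeight β N σ

/-- Expectation with respect to the Curie–Weiss distribution `CW(β,N)`. -/
noncomputable def cwExp (β : ℝ) (N : ℕ) (f : (Fin N → Bool) → ℝ) : ℝ :=
  (∑ σ : Fin N → Bool, cwWeight β N σ * f σ) / cwZ β N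

/-- Law on `ℝ` of the observable `g` under the Curie–Weiss distribution `CW(β,N)`. -/
noncomputable def cwLaw (β : ℝ) (N : ℕ) (g : (Fin N → Bool) → ℝ) : Measure ℝ :=
  ∑ σ : Fin N → Bool, ENNReal.ofReal (cwWeight β N σ / cwZ β N) • Measure.dirac (g σ)

/-- The correlation `E_{β,N}(X_1 ⋯ X_ℓ)` of the first `ℓ` spins. -/
noncomputable def cwCorr (β : ℝ) (N ℓ : ℕ) : ℝ :=
  cwExp β N (fun σ => ∏ j ∈ Finset.univ.filter (fun j : Fin N => (j : ℕ) < ℓ), spin (σ j))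

/-- Quartic sharpening of `Real.cosh_le_exp_half_sq`. -/
theorem cosh_add_pow_four_le_exp_half_sq (x : ℝ) :
    cosh x + x ^ 4 / 12 ≤ exp (x ^ 2 / 2) := by
  have hexp : HasSum (fun n : ℕ => (x ^ 2 / 2) ^ n / (n.factorial : ℝ)) (exp (x ^ 2 / 2)) := by
    rw [exp_eq_exp_ℝ]
    exact NormedSpace.expSeries_div_hasSum_exp (x ^ 2 / 2)
  have hdiff := hexp.sub (hasSum_cosh x)
  have hterm : ∀ n : ℕ, 0 ≤ (x ^ 2 / 2) ^ n / (n.factorial : ℝ) -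
      x ^ (2 * n) / ((2 * n).factorial : ℝ) := fun n => by
    rw [sub_nonneg, div_pow, pow_mul, div_div]
    gcongr
    · exact_mod_cast Nat.two_pow_mul_factorial_le_factorial_two_mul n
  have h := sum_le_hasSum {2} (fun n _ => hterm n) hdiff
  norm_num [Nat.factorial] at h
  linarith

theorem quartic_le_cosh (x : ℝ) : 1 + x ^ 2 / 2 + x ^ 4 / 24 ≤ cosh x := by
  have h := sum_le_hasSum (Finset.range 3)
    (fun n _ => by rw [pow_mul]; positivity) (hasSum_cosh x)
  norm_num [Finset.sum_range_succ, Nat.factorial] at h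
  linarith

theorem exp_half_sq_le_cosh_add {x : ℝ} (hx : |x| ≤ 1) :
    exp (x ^ 2 / 2) ≤ cosh x + x ^ 4 / 12 + x ^ 6 / 36 := by
  have hx2 : x ^ 2 ≤ 1 := by rwa [sq_le_one_iff_abs_le_one]
  have h := exp_bound' (x := x ^ 2 / 2) (by positivity) (by linarith) (n := 3) (by norm_num)
  norm_num [Finset.sum_range_succ, Nat.factorial] at h
  have := quartic_le_cosh x
  nlinarith

theorem exp_neg_half_sq_mul_cosh_le (x : ℝ) :
    exp (-(x ^ 2 / 2)) * cosh x ≤ exp (-(exp (-8) / 12 * (x ^ 4 / (1 + x ^ 2)))) := by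
  have he8 : exp (-8) ≤ 1 := exp_le_one_iff.2 (by norm_num)
  have he8' := exp_pos (-8)
  have hpos := exp_pos (-(x ^ 2 / 2))
  rcases le_total |x| 4 with hx | hx
  · have hx2 : x ^ 2 ≤ 16 := by
      have := sq_le_sq' (by linarith [abs_nonneg x]) hx
      rw [sq_abs] at this
      linarith
    have hmul : exp (-(x ^ 2 / 2)) * exp (x ^ 2 / 2) = 1 := by rw [← exp_add]; simp
    have h8 : exp (-8) ≤ exp (-(x ^ 2 / 2)) := exp_le_exp.2 (by linarith)
    have hx4 : 0 ≤ x ^ 4 := by positivity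
    have hfrac : x ^ 4 / (1 + x ^ 2) ≤ x ^ 4 := div_le_self hx4 (by nlinarith)
    calc exp (-(x ^ 2 / 2)) * cosh x
        ≤ exp (-(x ^ 2 / 2)) * (exp (x ^ 2 / 2) - x ^ 4 / 12) := by
          gcongr; linarith [cosh_add_pow_four_le_exp_half_sq x]
      _ ≤ 1 - exp (-8) / 12 * x ^ 4 := by nlinarith
      _ ≤ 1 - exp (-8) / 12 * (x ^ 4 / (1 + x ^ 2)) := by gcongr
      _ ≤ _ := one_sub_le_exp_neg _
  · have hcosh : cosh x ≤ exp |x| := by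
      rw [← cosh_abs, cosh_eq]
      have : exp (-|x|) ≤ exp |x| := exp_le_exp.2 (by linarith [abs_nonneg x])
      linarith
    have hfrac : x ^ 4 / (1 + x ^ 2) ≤ x ^ 2 := by
      rw [div_le_iff₀ (by positivity)]; nlinarith [sq_nonneg x]
    have hfrac0 : 0 ≤ x ^ 4 / (1 + x ^ 2) := by positivity
    calc exp (-(x ^ 2 / 2)) * cosh x ≤ exp (-(x ^ 2 / 2)) * exp |x| := by gcongr
      _ = exp (-(x ^ 2 / 2) + |x|) := (exp_add _ _).symm
      _ ≤ _ := by
        apply exp_le_exp.2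
        have := sq_abs x
        nlinarith

/-- Uniform Gaussian domination of the rescaled Hubbard–Stratonovich density. -/
theorem exp_neg_half_sq_mul_cosh_pow_le {a : ℝ} (ha : 1 ≤ a) {N : ℕ} (hN : a ^ 4 = N) (t : ℝ) :
    (exp (-((t / a) ^ 2 / 2)) * cosh (t / a)) ^ N ≤
      exp (exp (-8) / 12) * exp (-(exp (-8) / 12) * t ^ 2) := by
  have ha0 : 0 < a := by linarith
  calc (exp (-((t / a) ^ 2 / 2)) * cosh (t / a)) ^ N
      ≤ exp (-(exp (-8) / 12 * ((t / a) ^ 4 / (1 + (t / a) ^ 2)))) ^ N := by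
        gcongr
        exact exp_neg_half_sq_mul_cosh_le _
    _ = exp (-(exp (-8) / 12) * (a ^ 4 * ((t / a) ^ 4 / (1 + (t / a) ^ 2)))) := by
        rw [← exp_nat_mul, hN]; ring_nf
    _ ≤ exp (exp (-8) / 12 + -(exp (-8) / 12) * t ^ 2) := by
        apply exp_le_exp.2
        have h : t ^ 2 - 1 ≤ a ^ 4 * ((t / a) ^ 4 / (1 + (t / a) ^ 2)) := by
          have hta : (t / a) ^ 2 ≤ t ^ 2 := by
            rw [div_pow]; exact div_le_self (sq_nonneg t) (by nlinarith)
          have h4 : a ^ 4 * (t / a) ^ 4 = t ^ 4 := by field_simp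
          rw [← mul_div_assoc, h4, le_div_iff₀ (by positivity)]
          rcases le_total (t ^ 2) 1 with h1 | h1
          · nlinarith [sq_nonneg (t / a), sq_nonneg (t ^ 2)]
          · nlinarith
        nlinarith [exp_pos (-8)]
    _ = _ := exp_add _ _

theorem tendsto_exp_neg_half_sq_mul_cosh_pow (t : ℝ) :
    Tendsto (fun N : ℕ => (exp (-((t / (N : ℝ) ^ (1 / 4 : ℝ)) ^ 2 / 2)) *
      cosh (t / (N : ℝ) ^ (1 / 4 : ℝ))) ^ N) atTop (𝓝 (exp (-(t ^ 4) / 12))) := by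
  have hroot : Tendsto (fun N : ℕ => (N : ℝ) ^ (1 / 4 : ℝ)) atTop atTop :=
    (tendsto_rpow_atTop (by norm_num)).comp tendsto_natCast_atTop_atTop
  have hx : Tendsto (fun N : ℕ => t / (N : ℝ) ^ (1 / 4 : ℝ)) atTop (𝓝 0) :=
    tendsto_const_nhds.div_atTop hroot
  have hpow4 : ∀ᶠ N : ℕ in atTop, (N : ℝ) * (t / (N : ℝ) ^ (1 / 4 : ℝ)) ^ 4 = t ^ 4 := by
    filter_upwards [eventually_gt_atTop 0] with N hN
    have hN' : (0 : ℝ) < N := by exact_mod_cast hN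
    rw [div_pow, ← rpow_mul_natCast hN'.le]
    norm_num
    field_simp
  have hsmall : ∀ᶠ N : ℕ in atTop, |t / (N : ℝ) ^ (1 / 4 : ℝ)| ≤ 1 := by
    have := hx.abs
    rw [abs_zero] at this
    exact (this.eventually_lt_const one_pos).mono fun _ h => h.le
  have hE : Tendsto (fun N : ℕ => exp (-((t / (N : ℝ) ^ (1 / 4 : ℝ)) ^ 2 / 2))) atTop (𝓝 1) := by
    have := (((hx.pow 2).div_const 2).neg).rexp
    simpa using this
  have hmain : Tendsto (fun N : ℕ => (N : ℝ) * (exp (-((t / (N : ℝ) ^ (1 / 4 : ℝ)) ^ 2 / 2)) *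
      cosh (t / (N : ℝ) ^ (1 / 4 : ℝ)) - 1)) atTop (𝓝 (-(t ^ 4) / 12)) := by
    refine tendsto_of_tendsto_of_tendsto_of_le_of_le'
      (g := fun N : ℕ => exp (-((t / (N : ℝ) ^ (1 / 4 : ℝ)) ^ 2 / 2)) *
        (-(t ^ 4) / 12 - t ^ 4 * (t / (N : ℝ) ^ (1 / 4 : ℝ)) ^ 2 / 36))
      (h := fun N : ℕ => exp (-((t / (N : ℝ) ^ (1 / 4 : ℝ)) ^ 2 / 2)) * (-(t ^ 4) / 12))
      ?_ ?_ ?_ ?_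
    · have := hE.mul ((((hx.pow 2).const_mul (t ^ 4)).div_const 36).const_sub (-(t ^ 4) / 12))
      simpa using this
    · simpa using hE.mul_const (-(t ^ 4) / 12)
    · filter_upwards [hpow4, hsmall] with N h4 h1
      set x := t / (N : ℝ) ^ (1 / 4 : ℝ)
      have hmul : exp (-(x ^ 2 / 2)) * exp (x ^ 2 / 2) = 1 := by rw [← exp_add]; simp
      calc exp (-(x ^ 2 / 2)) * (-(t ^ 4) / 12 - t ^ 4 * x ^ 2 / 36)
          = N * (exp (-(x ^ 2 / 2)) * (-(x ^ 4 / 12) - x ^ 6 / 36)) := by rw [← h4]; ring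
        _ ≤ N * (exp (-(x ^ 2 / 2)) * (cosh x - exp (x ^ 2 / 2))) := by
          have : -(x ^ 4 / 12) - x ^ 6 / 36 ≤ cosh x - exp (x ^ 2 / 2) := by
            linarith [exp_half_sq_le_cosh_add h1]
          gcongr
        _ = _ := by rw [mul_sub (exp _), hmul]
    · filter_upwards [hpow4] with N h4
      set x := t / (N : ℝ) ^ (1 / 4 : ℝ)
      have hmul : exp (-(x ^ 2 / 2)) * exp (x ^ 2 / 2) = 1 := by rw [← exp_add]; simp
      calc (N : ℝ) * (exp (-(x ^ 2 / 2)) * cosh x - 1)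
          = N * (exp (-(x ^ 2 / 2)) * (cosh x - exp (x ^ 2 / 2))) := by
            rw [mul_sub (exp _), hmul]
        _ ≤ N * (exp (-(x ^ 2 / 2)) * (-(x ^ 4 / 12))) := by
          have : cosh x - exp (x ^ 2 / 2) ≤ -(x ^ 4 / 12) := by
            linarith [cosh_add_pow_four_le_exp_half_sq x]
          gcongr
        _ = _ := by rw [← h4]; ring
  refine (tendsto_one_add_pow_exp_of_tendsto hmain).congr fun N => ?_
  rw [add_sub_cancel]

theorem integrable_pow_mul_exp_neg_mul_sq (j : ℕ) {b : ℝ} (hb : 0 < b) :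
    Integrable fun x : ℝ => x ^ j * exp (-b * x ^ 2) := by
  simpa using integrable_rpow_mul_exp_neg_mul_sq hb (s := j) (by linarith [j.cast_nonneg (α := ℝ)])

theorem tendsto_integral_pow_mul_cosh_pow (K : ℕ) :
    Tendsto (fun N : ℕ => ∫ t : ℝ, t ^ K * (exp (-((t / (N : ℝ) ^ (1 / 4 : ℝ)) ^ 2 / 2)) *
      cosh (t / (N : ℝ) ^ (1 / 4 : ℝ))) ^ N) atTop
      (𝓝 (∫ t : ℝ, t ^ K * exp (-(t ^ 4) / 12))) := by
  have hc : 0 < exp (-8) / 12 := by positivity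
  refine tendsto_integral_filter_of_dominated_convergence
    (fun t => exp (exp (-8) / 12) * |t ^ K * exp (-(exp (-8) / 12) * t ^ 2)|) ?_ ?_ ?_ ?_
  · refine Eventually.of_forall fun N => Continuous.aestronglyMeasurable ?_
    fun_prop
  · filter_upwards [eventually_ge_atTop 1] with N hN
    have hN' : (1 : ℝ) ≤ N := by exact_mod_cast hN
    refine Eventually.of_forall fun t => ?_
    have hle := exp_neg_half_sq_mul_cosh_pow_le (one_le_rpow hN' (by norm_num : (0 : ℝ) ≤ 1 / 4))
      (N := N) (by rw [← rpow_mul_natCast (by linarith)]; norm_num) t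
    have h0 : 0 ≤ (exp (-((t / (N : ℝ) ^ (1 / 4 : ℝ)) ^ 2 / 2)) *
        cosh (t / (N : ℝ) ^ (1 / 4 : ℝ))) ^ N :=
      pow_nonneg (mul_nonneg (exp_pos _).le (cosh_pos _).le) _
    rw [norm_mul, norm_of_nonneg h0, norm_eq_abs, abs_mul, abs_of_pos (exp_pos (_ * t ^ 2)),
      mul_left_comm]
    gcongr
  · exact (integrable_pow_mul_exp_neg_mul_sq K hc).abs.const_mul _
  · exact Eventually.of_forall fun t => (tendsto_exp_neg_half_sq_mul_cosh_pow t).const_mul _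

theorem integral_exp_neg_pow_four_div_pos : 0 < ∫ t : ℝ, exp (-(t ^ 4) / 12) := by
  refine integral_exp_pos (μ := volume) (f := fun t : ℝ => -(t ^ 4) / 12) ?_
  refine ((integrable_pow_mul_exp_neg_mul_sq 0 (b := 1 / 12) (by norm_num)).const_mul
    (exp 1)).mono' (by fun_prop) (Eventually.of_forall fun t => ?_)
  rw [norm_of_nonneg (exp_pos _).le, pow_zero, one_mul, ← exp_add]
  exact exp_le_exp.2 (by nlinarith [sq_nonneg (t ^ 2 - 1), sq_nonneg t])

/-- The unnormalized `j`-th moment of the standard Gaussian density. -/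
noncomputable def gaussianWeightMoment (j : ℕ) : ℝ := ∫ x : ℝ, x ^ j * exp (-(1 / 2) * x ^ 2)

theorem gaussianWeightMoment_zero_pos : 0 < gaussianWeightMoment 0 := by
  rw [gaussianWeightMoment]
  simp only [pow_zero, one_mul]
  rw [integral_gaussian]
  positivity

/-- The tilted Gaussian `exp (-a² t² / 2 + s t / a)` after completing the square. -/
theorem pow_mul_exp_tilted_eq {a : ℝ} (ha : 0 < a) (s : ℝ) (K : ℕ) (t : ℝ) :
    t ^ K * exp (-(a ^ 2 * t ^ 2 / 2) + s * (t / a)) =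
      exp (s ^ 2 / (2 * a ^ 4)) * ∑ j ∈ Finset.range (K + 1),
        K.choose j * (s / a ^ 3) ^ (K - j) * a⁻¹ ^ j *
          ((a * (t - s / a ^ 3)) ^ j * exp (-(1 / 2) * (a * (t - s / a ^ 3)) ^ 2)) := by
  have hexp : exp (-(a ^ 2 * t ^ 2 / 2) + s * (t / a)) =
      exp (s ^ 2 / (2 * a ^ 4)) * exp (-(1 / 2) * (a * (t - s / a ^ 3)) ^ 2) := by
    rw [← exp_add]
    congr 1
    field_simp
    ring
  have hbin : t ^ K = ∑ j ∈ Finset.range (K + 1),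
      K.choose j * (s / a ^ 3) ^ (K - j) * a⁻¹ ^ j * (a * (t - s / a ^ 3)) ^ j := by
    have ht : t = a⁻¹ * (a * (t - s / a ^ 3)) + s / a ^ 3 := by field_simp; ring
    conv_lhs => rw [ht, add_pow]
    refine Finset.sum_congr rfl fun j _ => ?_
    rw [mul_pow a⁻¹]
    ring
  rw [hexp, hbin, Finset.sum_mul, Finset.mul_sum]
  refine Finset.sum_congr rfl fun j _ => ?_
  ring

theorem integrable_tilted_term {a : ℝ} (ha : 0 < a) (m : ℝ) (j : ℕ) :
    Integrable fun t : ℝ => (a * (t - m)) ^ j * exp (-(1 / 2) * (a * (t - m)) ^ 2) :=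
  ((integrable_pow_mul_exp_neg_mul_sq j (b := 1 / 2) (by norm_num)).comp_mul_left'
    ha.ne').comp_sub_right m

theorem integral_tilted_term {a : ℝ} (ha : 0 < a) (m : ℝ) (j : ℕ) :
    ∫ t : ℝ, (a * (t - m)) ^ j * exp (-(1 / 2) * (a * (t - m)) ^ 2) =
      a⁻¹ * gaussianWeightMoment j := by
  rw [integral_sub_right_eq_self (fun x : ℝ => (a * x) ^ j * exp (-(1 / 2) * (a * x) ^ 2)) m,
    Measure.integral_comp_mul_left (fun x : ℝ => x ^ j * exp (-(1 / 2) * x ^ 2)) a,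
    abs_of_pos (inv_pos.2 ha), smul_eq_mul, gaussianWeightMoment]

theorem integrable_pow_mul_exp_tilted {a : ℝ} (ha : 0 < a) (s : ℝ) (K : ℕ) :
    Integrable fun t : ℝ => t ^ K * exp (-(a ^ 2 * t ^ 2 / 2) + s * (t / a)) := by
  simp only [pow_mul_exp_tilted_eq ha]
  exact (integrable_finsetSum _ fun j _ =>
    (integrable_tilted_term ha _ j).const_mul _).const_mul _

theorem integral_pow_mul_exp_tilted {a : ℝ} (ha : 0 < a) (s : ℝ) (K : ℕ) :
    ∫ t : ℝ, t ^ K * exp (-(a ^ 2 * t ^ 2 / 2) + s * (t / a)) =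
      exp (s ^ 2 / (2 * a ^ 4)) * ∑ j ∈ Finset.range (K + 1),
        K.choose j * (s / a ^ 3) ^ (K - j) * a⁻¹ ^ j * (a⁻¹ * gaussianWeightMoment j) := by
  simp only [pow_mul_exp_tilted_eq ha]
  rw [integral_const_mul, integral_finsetSum _ fun j _ =>
    (integrable_tilted_term ha _ j).const_mul _]
  simp only [integral_const_mul, integral_tilted_term ha]

theorem sum_exp_spin_mul (N : ℕ) (x : ℝ) :
    ∑ σ : Fin N → Bool, exp ((∑ i, spin (σ i)) * x) = (2 * cosh x) ^ N := by
  have hcosh : 2 * cosh x = ∑ b : Bool, exp (spin b * x) := by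
    simp [spin, cosh_eq]; ring
  rw [hcosh, Fintype.sum_pow]
  simp only [Finset.sum_mul, exp_sum]

/-- The Hubbard–Stratonovich identity: the density proportional to
`(exp (-x² / 2) cosh x) ^ N`, `x = t / N ^ (1 / 4)`, is that of the rescaled magnetization plus an
independent centred Gaussian of standard deviation `N ^ (-1 / 4)`. -/
theorem integral_pow_mul_cosh_pow_eq {a : ℝ} (ha : 0 < a) {N : ℕ} (hN : a ^ 4 = N) (K : ℕ) :
    2 ^ N * ∫ t : ℝ, t ^ K * (exp (-((t / a) ^ 2 / 2)) * cosh (t / a)) ^ N =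
      a⁻¹ * ∑ j ∈ Finset.range (K + 1), K.choose j * a⁻¹ ^ j * gaussianWeightMoment j *
        ∑ σ : Fin N → Bool, cwWeight 1 N σ * ((∑ i, spin (σ i)) / a ^ 3) ^ (K - j) := by
  have hpt : ∀ t : ℝ, 2 ^ N * (t ^ K * (exp (-((t / a) ^ 2 / 2)) * cosh (t / a)) ^ N) =
      ∑ σ : Fin N → Bool,
        t ^ K * exp (-(a ^ 2 * t ^ 2 / 2) + (∑ i, spin (σ i)) * (t / a)) := fun t => by
    have hgauss : exp (-((t / a) ^ 2 / 2)) ^ N = exp (-(a ^ 2 * t ^ 2 / 2)) := by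
      rw [← exp_nat_mul, ← hN]
      congr 1
      field_simp
    simp only [exp_add, ← Finset.mul_sum, sum_exp_spin_mul]
    rw [mul_pow, mul_pow, hgauss]
    ring
  rw [← integral_const_mul]
  simp only [hpt]
  rw [integral_finsetSum _ fun σ _ => integrable_pow_mul_exp_tilted ha _ K]
  simp only [integral_pow_mul_exp_tilted ha, Finset.mul_sum]
  rw [Finset.sum_comm]
  refine Finset.sum_congr rfl fun j _ => Finset.sum_congr rfl fun σ _ => ?_
  have hw : cwWeight 1 N σ = exp ((∑ i, spin (σ i)) ^ 2 / (2 * a ^ 4)) := by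
    rw [cwWeight, hN]
    congr 1
    ring
  rw [hw]
  ring

theorem cwZ_pos (β : ℝ) (N : ℕ) : 0 < cwZ β N :=
  Finset.sum_pos (fun _ _ => exp_pos _) Finset.univ_nonempty

theorem integral_ratio_eq_sum_cwExp {a : ℝ} (ha : 0 < a) {N : ℕ} (hN : a ^ 4 = N) (K : ℕ) :
    (∫ t : ℝ, t ^ K * (exp (-((t / a) ^ 2 / 2)) * cosh (t / a)) ^ N) /
        (∫ t : ℝ, t ^ 0 * (exp (-((t / a) ^ 2 / 2)) * cosh (t / a)) ^ N) =
      ∑ j ∈ Finset.range (K + 1), K.choose j * a⁻¹ ^ j *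
        (gaussianWeightMoment j / gaussianWeightMoment 0) *
          cwExp 1 N (fun σ => ((∑ i, spin (σ i)) / a ^ 3) ^ (K - j)) := by
  have hg := gaussianWeightMoment_zero_pos.ne'
  have hZ := (cwZ_pos 1 N).ne'
  have h0 := integral_pow_mul_cosh_pow_eq ha hN 0
  simp only [zero_add, Finset.sum_range_one, Nat.choose_self, Nat.cast_one, pow_zero, mul_one,
    one_mul, Nat.sub_self] at h0
  rw [← cwZ] at h0
  simp only [pow_zero, one_mul]
  rw [← mul_div_mul_left _ _ (pow_ne_zero N (two_ne_zero' ℝ)),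
    integral_pow_mul_cosh_pow_eq ha hN K, h0, mul_div_mul_left _ _ (inv_ne_zero ha.ne'),
    Finset.sum_div]
  refine Finset.sum_congr rfl fun j _ => ?_
  rw [cwExp]
  field_simp

/-- Moment convergence at the critical point: `E_{1,N}((S_N/N^{3/4})^K)` converges to
`(∫ t^K e^{−t⁴/12} dt)/(∫ e^{−t⁴/12} dt)`, the `K`-th moment of the probability measure
with density proportional to `e^{−t⁴/12}`. -/
theorem cw_critical_moments (K : ℕ) :
    Tendsto (fun N : ℕ =>
        cwExp 1 N (fun σ => ((∑ i, spin (σ i)) / (N : ℝ) ^ ((3 : ℝ) / 4)) ^ K))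
      atTop (𝓝 ((∫ t : ℝ, t ^ K * Real.exp (-(t ^ 4) / 12)) /
        (∫ t : ℝ, Real.exp (-(t ^ 4) / 12)))) := by
  have hroot : Tendsto (fun N : ℕ => ((N : ℝ) ^ (1 / 4 : ℝ))⁻¹) atTop (𝓝 0) :=
    ((tendsto_rpow_atTop (by norm_num)).comp tendsto_natCast_atTop_atTop).inv_tendsto_atTop
  induction K using Nat.strong_induction_on with
  | _ K ih =>
  have hratio := (tendsto_integral_pow_mul_cosh_pow K).div (tendsto_integral_pow_mul_cosh_pow 0)
    (by simpa using integral_exp_neg_pow_four_div_pos.ne')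
  have hrest : Tendsto (fun N : ℕ => ∑ j ∈ Finset.range K, K.choose (j + 1) *
      ((N : ℝ) ^ (1 / 4 : ℝ))⁻¹ ^ (j + 1) *
        (gaussianWeightMoment (j + 1) / gaussianWeightMoment 0) *
          cwExp 1 N (fun σ => ((∑ i, spin (σ i)) / (N : ℝ) ^ ((3 : ℝ) / 4)) ^ (K - (j + 1))))
      atTop (𝓝 0) := by
    rw [← Finset.sum_const_zero (ι := ℕ) (M := ℝ) (s := Finset.range K)]
    refine tendsto_finsetSum _ fun j hj => ?_
    have hj' := Finset.mem_range.1 hj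
    have := (((hroot.pow (j + 1)).const_mul (K.choose (j + 1) : ℝ)).mul_const
      (gaussianWeightMoment (j + 1) / gaussianWeightMoment 0)).mul (ih (K - (j + 1)) (by omega))
    simpa using this
  have hlim := hratio.sub hrest
  simp only [pow_zero, one_mul, sub_zero] at hlim
  refine hlim.congr' ?_
  filter_upwards [eventually_gt_atTop 0] with N hN
  have hN' : (0 : ℝ) < N := by exact_mod_cast hN
  have h3 : (N : ℝ) ^ ((3 : ℝ) / 4) = ((N : ℝ) ^ (1 / 4 : ℝ)) ^ 3 := by
    rw [← rpow_mul_natCast hN'.le]; norm_num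
  have hid := integral_ratio_eq_sum_cwExp (rpow_pos_of_pos hN' (1 / 4)) (N := N)
    (by rw [← rpow_mul_natCast hN'.le]; norm_num) K
  rw [Finset.sum_range_succ', ← h3] at hid
  simp only [pow_zero, one_mul] at hid
  simp only [Pi.div_apply]
  rw [hid]
  simp [div_self gaussianWeightMoment_zero_pos.ne']
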